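/- Assume the square-integrability condition, the surjectivity assumption, and that π(s₁)* = Id_H for some s₁ in the support of μ. Let Ω be a bounded subset of H. Then the following are equivalent: (1) Ω is relatively compact in H; (2) for some (equivalently, for every) unit vector w ∈ H, the family φ^π_w(Ω) is K(Σ)-tight in L²(Σ,μ); (3) for every ε > 0 there exists f ∈ C_c(Σ) with sup_{u ∈ Ω} ‖Π(f)u − u‖ ≤ ε; (4) for every s₀ ∈ Σ, lim_{s → s₀} sup_{u ∈ Ω} ‖π(s)*u − π(s₀)*u‖ = 0. -/

import Mathlib

open MeasureTheory ComplexConjugate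
open scoped ComplexInnerProductSpace Topology

section Compactness

variable {E : Type*} [NormedAddCommGroup E] [InnerProductSpace ℂ E] [CompleteSpace E]

/-- A bounded set is relatively compact as soon as, for every `ε > 0`, its elements pair with the
orthogonal complement of some finite-dimensional subspace with norm at most `ε`. -/
theorem isCompact_closure_of_inner_orthogonal_le {Ω : Set E} (hΩ : Bornology.IsBounded Ω)
    (h : ∀ ε > (0 : ℝ), ∃ F : Submodule ℂ E, FiniteDimensional ℂ F ∧
      ∀ u ∈ Ω, ∀ x ∈ Fᗮ, ‖⟪x, u⟫‖ ≤ ε * ‖x‖) :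
    IsCompact (closure Ω) := by
  refine (TotallyBounded.closure ?_).isCompact_of_isClosed isClosed_closure
  rw [Metric.totallyBounded_iff]
  intro ε hε
  obtain ⟨F, hF, hFΩ⟩ := h (ε / 2) (by positivity)
  obtain ⟨R, hR⟩ := hΩ.exists_norm_le
  obtain ⟨t, -, ht, hcov⟩ :=
    (isCompact_closedBall (0 : F) R).finite_cover_balls (half_pos hε)
  refine ⟨(↑) '' t, ht.image _, fun u hu => ?_⟩
  have hproj : F.orthogonalProjectionOnto u ∈ Metric.closedBall (0 : F) R := by
    rw [mem_closedBall_zero_iff]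
    exact (F.norm_orthogonalProjectionOnto_apply_le u).trans (hR u hu)
  obtain ⟨y, hy, hyu⟩ := Set.mem_iUnion₂.1 (hcov hproj)
  refine Set.mem_iUnion₂.2 ⟨y, Set.mem_image_of_mem _ hy, ?_⟩
  have hmem : u - F.starProjection u ∈ Fᗮ := F.sub_starProjection_mem_orthogonal u
  have hle : ‖u - F.starProjection u‖ ≤ ε / 2 := by
    have h₁ := hFΩ u hu _ hmem
    have h₂ : ⟪u - F.starProjection u, u⟫ =
        ⟪u - F.starProjection u, u - F.starProjection u⟫ := by
      rw [inner_sub_right (u - F.starProjection u) u (F.starProjection u),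
        F.starProjection_inner_eq_zero u _ (F.starProjection_apply_mem u), sub_zero]
    rw [h₂, inner_self_eq_norm_sq_to_K, norm_pow, RCLike.norm_ofReal, abs_norm] at h₁
    by_contra! hlt
    nlinarith
  rw [Metric.mem_ball] at hyu ⊢
  have hyu' : dist (F.starProjection u) (y : E) < ε / 2 := hyu
  calc dist u (y : E) ≤ dist u (F.starProjection u) + dist (F.starProjection u) (y : E) :=
        dist_triangle _ _ _
    _ < ε := by rw [dist_eq_norm u]; linarith

end Compactness

section SquareIntegrable

variable {α : Type*} [MeasurableSpace α] {ν : Measure α} {f g : α → ℂ}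

theorem MeasureTheory.MemLp.norm_toLp_sq_eq_integral (hf : MemLp f 2 ν) :
    ‖hf.toLp f‖ ^ 2 = ∫ a, ‖f a‖ ^ 2 ∂ν := by
  have h : ((‖hf.toLp f‖ ^ 2 : ℝ) : ℂ) = ((∫ a, ‖f a‖ ^ 2 ∂ν : ℝ) : ℂ) := by
    rw [← integral_complex_ofReal, Complex.ofReal_pow]
    refine (inner_self_eq_norm_sq_to_K (𝕜 := ℂ) (hf.toLp f)).symm.trans ?_
    rw [L2.inner_def]
    refine integral_congr_ae ?_
    filter_upwards [hf.coeFn_toLp] with a ha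
    rw [ha, inner_self_eq_norm_sq_to_K]
    simp
  exact_mod_cast h

theorem MeasureTheory.MemLp.inner_toLp_eq_integral (hf : MemLp f 2 ν) (hg : MemLp g 2 ν) :
    ⟪hf.toLp f, hg.toLp g⟫ = ∫ a, ⟪f a, g a⟫ ∂ν := by
  rw [L2.inner_def]
  refine integral_congr_ae ?_
  filter_upwards [hf.coeFn_toLp, hg.coeFn_toLp] with a hfa hga
  rw [hfa, hga]

theorem MeasureTheory.MemLp.integrable_inner (hf : MemLp f 2 ν) (hg : MemLp g 2 ν) :
    Integrable (fun a => ⟪f a, g a⟫) ν := by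
  refine (L2.integrable_inner (𝕜 := ℂ) (hf.toLp f) (hg.toLp g)).congr ?_
  filter_upwards [hf.coeFn_toLp, hg.coeFn_toLp] with a hfa hga
  rw [hfa, hga]

theorem MeasureTheory.MemLp.norm_integral_inner_le (hf : MemLp f 2 ν) (hg : MemLp g 2 ν) :
    ‖∫ a, ⟪f a, g a⟫ ∂ν‖ ≤ √(∫ a, ‖f a‖ ^ 2 ∂ν) * √(∫ a, ‖g a‖ ^ 2 ∂ν) := by
  rw [← hf.inner_toLp_eq_integral hg, ← hf.norm_toLp_sq_eq_integral,
    ← hg.norm_toLp_sq_eq_integral, Real.sqrt_sq (norm_nonneg _), Real.sqrt_sq (norm_nonneg _)]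
  exact norm_inner_le_norm _ _

end SquareIntegrable

section Coefficients

variable {Sp : Type*} [MeasurableSpace Sp] {μ : Measure Sp}
  {H : Type*} [NormedAddCommGroup H] [InnerProductSpace ℂ H]
  {π : Sp → H →L[ℂ] H}

/-- The matrix coefficient `s ↦ ⟪v, π s u⟫` as an element of `L²`. -/
noncomputable def coeffLp (h : ∀ u v : H, MemLp (fun s => ⟪v, π s u⟫) 2 μ) (u v : H) :
    Lp ℂ 2 μ :=
  (h u v).toLp _

variable (h : ∀ u v : H, MemLp (fun s => ⟪v, π s u⟫) 2 μ)

theorem coeffLp_add_left (u u' v : H) :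
    coeffLp h (u + u') v = coeffLp h u v + coeffLp h u' v := by
  rw [coeffLp, coeffLp, coeffLp, ← MemLp.toLp_add]
  congr 1
  ext s
  simp

theorem coeffLp_smul_left (c : ℂ) (u v : H) : coeffLp h (c • u) v = c • coeffLp h u v := by
  rw [coeffLp, coeffLp, ← MemLp.toLp_const_smul]
  congr 1
  ext s
  simp

theorem coeffLp_add_right (u v v' : H) :
    coeffLp h u (v + v') = coeffLp h u v + coeffLp h u v' := by
  rw [coeffLp, coeffLp, coeffLp, ← MemLp.toLp_add]
  congr 1
  ext s
  simp

theorem coeffLp_smul_right (c : ℂ) (u v : H) :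
    coeffLp h u (c • v) = conj c • coeffLp h u v := by
  rw [coeffLp, coeffLp, ← MemLp.toLp_const_smul]
  congr 1
  ext s
  simp [mul_comm]

variable (hsq : ∀ u v : H, ∫ s, ‖⟪v, π s u⟫‖ ^ 2 ∂μ = ‖u‖ ^ 2 * ‖v‖ ^ 2)

include hsq

theorem norm_coeffLp (u v : H) : ‖coeffLp h u v‖ = ‖u‖ * ‖v‖ := by
  have h₁ : ‖coeffLp h u v‖ ^ 2 = (‖u‖ * ‖v‖) ^ 2 := by
    rw [coeffLp, MemLp.norm_toLp_sq_eq_integral, hsq, mul_pow]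
  exact (pow_left_inj₀ (norm_nonneg _) (by positivity) two_ne_zero).1 h₁

theorem inner_coeffLp_same (x y v : H) :
    ⟪coeffLp h x v, coeffLp h y v⟫ = ‖v‖ ^ 2 * ⟪x, y⟫ := by
  let T : H →ₗ[ℂ] Lp ℂ 2 μ :=
    { toFun := fun u => coeffLp h u v
      map_add' := fun u u' => coeffLp_add_left h u u' v
      map_smul' := fun c u => coeffLp_smul_left h c u v }
  have hT : ∀ u, ‖T u‖ = ‖u‖ * ‖v‖ := fun u => norm_coeffLp h hsq u v
  change ⟪T x, T y⟫ = _
  rw [inner_eq_sum_norm_sq_div_four (T x), inner_eq_sum_norm_sq_div_four x]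
  simp only [← map_add, ← map_sub, ← map_smul, hT]
  push_cast [RCLike.ofReal_eq_complex_ofReal]
  ring

theorem inner_coeffLp_eq_zero {x y : H} (hxy : ⟪x, y⟫ = 0) (v v' : H) :
    ⟪coeffLp h x v, coeffLp h y v'⟫ = 0 := by
  have hd : ∀ w, ⟪coeffLp h x w, coeffLp h y w⟫ = 0 := fun w => by
    rw [inner_coeffLp_same h hsq, hxy, mul_zero]
  have h₁ := hd (v + v')
  have h₂ := hd (v + Complex.I • v')
  simp only [coeffLp_add_right, coeffLp_smul_right, inner_add_left, inner_add_right,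
    inner_smul_left, inner_smul_right, hd, Complex.conj_I, map_neg] at h₁ h₂
  linear_combination (h₁ + Complex.I * h₂) / 2 +
    (⟪coeffLp h x v, coeffLp h y v'⟫ - ⟪coeffLp h x v', coeffLp h y v⟫) / 2 * Complex.I_sq

/-- Each element of the span of the matrix coefficients is orthogonal to all coefficients of
vectors orthogonal to some finite-dimensional subspace. -/
theorem exists_finiteDimensional_inner_coeffLp_eq_zero {g : Lp ℂ 2 μ}
    (hg : g ∈ Submodule.span ℂ {f : Lp ℂ 2 μ | ∃ u v : H,
      (f : Sp → ℂ) =ᵐ[μ] fun s => ⟪v, π s u⟫}) :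
    ∃ F : Submodule ℂ H, FiniteDimensional ℂ F ∧
      ∀ x ∈ Fᗮ, ∀ u, ⟪coeffLp h x u, g⟫ = 0 := by
  induction hg using Submodule.span_induction with
  | mem f hf =>
    obtain ⟨u, v, huv⟩ := hf
    have hf : f = coeffLp h u v := Lp.ext (huv.trans (h u v).coeFn_toLp.symm)
    refine ⟨ℂ ∙ u, inferInstance, fun x hx w => ?_⟩
    rw [hf]
    exact inner_coeffLp_eq_zero h hsq
      ((Submodule.mem_orthogonal' _ _).1 hx u (Submodule.mem_span_singleton_self u)) w v
  | zero => exact ⟨⊥, inferInstance, fun x _ w => inner_zero_right _⟩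
  | add f g _ _ hf hg =>
    obtain ⟨F, hF, hF'⟩ := hf
    obtain ⟨G, hG, hG'⟩ := hg
    refine ⟨F ⊔ G, inferInstance, fun x hx w => ?_⟩
    rw [inner_add_right, hF' x (Submodule.orthogonal_le le_sup_left hx),
      hG' x (Submodule.orthogonal_le le_sup_right hx), add_zero]
  | smul c f _ hf =>
    obtain ⟨F, hF, hF'⟩ := hf
    exact ⟨F, hF, fun x hx w => by rw [inner_smul_right, hF' x hx, mul_zero]⟩

end Coefficients

section Topological

variable {Sp : Type*} [TopologicalSpace Sp]
  {H : Type*} [NormedAddCommGroup H] [InnerProductSpace ℂ H] [CompleteSpace H]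
  {π : Sp → H →L[ℂ] H}

theorem continuous_inner_apply_of_continuous_adjoint
    (hcont : ∀ u : H, Continuous fun s => ContinuousLinearMap.adjoint (π s) u) (u v : H) :
    Continuous fun s => ⟪v, π s u⟫ := by
  simp only [← ContinuousLinearMap.adjoint_inner_left]
  exact (hcont v).inner continuous_const

/-- A strongly continuous family of operators is uniformly continuous at each point on relatively
compact sets. -/
theorem eventually_norm_sub_le_of_isCompact_closure [LocallyCompactSpace Sp]
    {A : Sp → H →L[ℂ] H} (hA : ∀ u, Continuous fun s => A s u) {Ω : Set H}
    (hΩ : IsCompact (closure Ω)) (s₀ : Sp) {ε : ℝ} (hε : 0 < ε) :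
    ∀ᶠ s in 𝓝 s₀, ∀ u ∈ Ω, ‖A s u - A s₀ u‖ ≤ ε := by
  obtain ⟨K, hK, hKs⟩ := exists_compact_mem_nhds s₀
  obtain ⟨C, hC⟩ := banach_steinhaus (g := fun s : K => A s) fun u =>
    let ⟨C, hC⟩ := hK.exists_bound_of_continuousOn (hA u).continuousOn
    ⟨C, fun s => hC s s.2⟩
  have hC₀ : 0 ≤ C := (norm_nonneg _).trans (hC ⟨s₀, mem_of_mem_nhds hKs⟩)
  obtain ⟨t, -, ht, hcov⟩ :=
    hΩ.finite_cover_balls (e := ε / (3 * (C + 1))) (by positivity)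
  have hev : ∀ᶠ s in 𝓝 s₀, ∀ y ∈ t, ‖A s y - A s₀ y‖ < ε / 3 := by
    refine (Filter.eventually_all_finite ht).2 fun y _ => ?_
    have hy := ((hA y).tendsto s₀).eventually (Metric.ball_mem_nhds _ (by positivity : 0 < ε / 3))
    filter_upwards [hy] with s hs
    rwa [dist_eq_norm] at hs
  filter_upwards [hev, hKs] with s hs hsK u hu
  obtain ⟨y, hy, hyu⟩ := Set.mem_iUnion₂.1 (hcov (subset_closure hu))
  rw [mem_ball_iff_norm] at hyu
  have hbound : ∀ r ∈ K, ‖A r (u - y)‖ ≤ ε / 3 := fun r hr =>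
    calc ‖A r (u - y)‖ ≤ C * (ε / (3 * (C + 1))) :=
          (A r).le_of_opNorm_le_of_le (hC ⟨r, hr⟩) hyu.le
      _ ≤ (C + 1) * (ε / (3 * (C + 1))) := by gcongr; linarith
      _ = ε / 3 := by field_simp
  calc ‖A s u - A s₀ u‖ = ‖A s (u - y) + (A s y - A s₀ y) - A s₀ (u - y)‖ := by
        simp only [map_sub]; congr 1; abel
    _ ≤ ‖A s (u - y)‖ + ‖A s y - A s₀ y‖ + ‖A s₀ (u - y)‖ :=
        (norm_sub_le _ _).trans (by gcongr; exact norm_add_le _ _)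
    _ ≤ ε / 3 + ε / 3 + ε / 3 := by
        gcongr
        · exact hbound s hsK
        · exact (hs y hy).le
        · exact hbound s₀ (mem_of_mem_nhds hKs)
    _ = ε := by ring

variable [MeasurableSpace Sp] [BorelSpace Sp] {μ : Measure Sp}

theorem memLp_two_inner_apply
    (hcont : ∀ u : H, Continuous fun s => ContinuousLinearMap.adjoint (π s) u)
    (hsq : ∀ u v : H, ∫ s, ‖⟪v, π s u⟫‖ ^ 2 ∂μ = ‖u‖ ^ 2 * ‖v‖ ^ 2) (u v : H) :
    MemLp (fun s => ⟪v, π s u⟫) 2 μ := by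
  rcases eq_or_ne u 0 with rfl | hu
  · simp
  rcases eq_or_ne v 0 with rfl | hv
  · simp
  rw [memLp_two_iff_integrable_sq_norm
    (continuous_inner_apply_of_continuous_adjoint hcont u v).aestronglyMeasurable]
  refine not_imp_comm.1 integral_undef ?_
  rw [hsq]
  positivity

/-- If the matrix coefficients span `L²`, then a bounded set on which the identity is
approximated by the operators `u ↦ ∫ f(s) π(s)* u dμ(s)` is relatively compact. -/
theorem isCompact_closure_of_norm_integral_smul_sub_le [IsFiniteMeasureOnCompacts μ]
    [SecondCountableTopology H]
    (hcont : ∀ u : H, Continuous fun s => ContinuousLinearMap.adjoint (π s) u)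
    (hsq : ∀ u v : H, ∫ s, ‖⟪v, π s u⟫‖ ^ 2 ∂μ = ‖u‖ ^ 2 * ‖v‖ ^ 2)
    (hsurj : (Submodule.span ℂ {f : Lp ℂ 2 μ | ∃ u v : H,
        (f : Sp → ℂ) =ᵐ[μ] fun s => ⟪v, π s u⟫}).topologicalClosure = ⊤)
    {Ω : Set H} (hΩ : Bornology.IsBounded Ω)
    (happrox : ∀ ε > (0 : ℝ), ∃ f : Sp → ℂ, Continuous f ∧ HasCompactSupport f ∧
      ∀ u ∈ Ω, ‖(∫ s, f s • ContinuousLinearMap.adjoint (π s) u ∂μ) - u‖ ≤ ε) :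
    IsCompact (closure Ω) := by
  have hmem := memLp_two_inner_apply hcont hsq
  refine isCompact_closure_of_inner_orthogonal_le hΩ fun ε hε => ?_
  obtain ⟨R, hR, hΩR⟩ := hΩ.exists_pos_norm_le
  obtain ⟨f, hfcont, hfsupp, hf⟩ := happrox (ε / 2) (half_pos hε)
  have hfmem : MemLp f 2 μ := hfcont.memLp_of_hasCompactSupport hfsupp
  have hfcl : hfmem.toLp f ∈ (Submodule.span ℂ {f : Lp ℂ 2 μ | ∃ u v : H,
      (f : Sp → ℂ) =ᵐ[μ] fun s => ⟪v, π s u⟫}).topologicalClosure :=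
    hsurj ▸ Submodule.mem_top
  obtain ⟨g, hg, hfg⟩ := Metric.mem_closure_iff.1 hfcl (ε / (2 * R)) (by positivity)
  rw [dist_eq_norm] at hfg
  obtain ⟨F, hF, hFg⟩ := exists_finiteDimensional_inner_coeffLp_eq_zero hmem hsq hg
  refine ⟨F, hF, fun u hu x hx => ?_⟩
  have hInt : Integrable (fun s => f s • ContinuousLinearMap.adjoint (π s) u) μ :=
    (hfcont.smul (hcont u)).integrable_of_hasCompactSupport hfsupp.smul_right
  have hinner : ⟪x, ∫ s, f s • ContinuousLinearMap.adjoint (π s) u ∂μ⟫ =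
      ⟪coeffLp hmem x u, hfmem.toLp f - g⟫ := by
    rw [inner_sub_right, hFg x hx u, sub_zero, coeffLp,
      (hmem x u).inner_toLp_eq_integral hfmem, ← integral_inner hInt]
    congr 1 with s
    rw [inner_smul_right, ContinuousLinearMap.adjoint_inner_right, RCLike.inner_apply,
      inner_conj_symm]
  calc ‖⟪x, u⟫‖
      = ‖⟪x, ∫ s, f s • ContinuousLinearMap.adjoint (π s) u ∂μ⟫ -
          ⟪x, (∫ s, f s • ContinuousLinearMap.adjoint (π s) u ∂μ) - u⟫‖ := by
        rw [← inner_sub_right, sub_sub_cancel]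
    _ ≤ ‖coeffLp hmem x u‖ * ‖hfmem.toLp f - g‖ +
          ‖x‖ * ‖(∫ s, f s • ContinuousLinearMap.adjoint (π s) u ∂μ) - u‖ := by
        refine (norm_sub_le _ _).trans (add_le_add ?_ (norm_inner_le_norm _ _))
        rw [hinner]
        exact norm_inner_le_norm _ _
    _ ≤ ‖x‖ * R * (ε / (2 * R)) + ‖x‖ * (ε / 2) := by
        rw [norm_coeffLp hmem hsq]
        gcongr
        · exact hΩR u hu
        · exact hf u hu
    _ = ε * ‖x‖ := by field_simp; ring

variable [T2Space Sp]

/-- Integrable functions on a `σ`-compact space have small integral off a compact set. -/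
theorem exists_isCompact_setIntegral_compl_le [LocallyCompactSpace Sp] [SigmaCompactSpace Sp]
    {g : Sp → ℝ} (hg : Integrable g μ) {ε : ℝ} (hε : 0 < ε) :
    ∃ L : Set Sp, IsCompact L ∧ ∫ s in Lᶜ, g s ∂μ ≤ ε := by
  let K := CompactExhaustion.choice Sp
  have hlim := tendsto_setIntegral_of_antitone (μ := μ) (f := g) (s := fun n => (K n)ᶜ)
    (fun n => (K.isCompact n).isClosed.measurableSet.compl)
    (fun m n hmn => Set.compl_subset_compl.2 (K.subset hmn)) ⟨0, hg.integrableOn⟩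
  rw [← Set.compl_iUnion, K.iUnion_eq, Set.compl_univ, setIntegral_empty] at hlim
  obtain ⟨n, hn⟩ := (hlim.eventually (gt_mem_nhds hε)).exists
  exact ⟨K n, K.isCompact n, hn.le⟩

/-- The coefficients of a relatively compact set are tight. -/
theorem tight_of_isCompact_closure [LocallyCompactSpace Sp] [SigmaCompactSpace Sp]
    (hcont : ∀ u : H, Continuous fun s => ContinuousLinearMap.adjoint (π s) u)
    (hsq : ∀ u v : H, ∫ s, ‖⟪v, π s u⟫‖ ^ 2 ∂μ = ‖u‖ ^ 2 * ‖v‖ ^ 2)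
    {Ω : Set H} (hΩ : IsCompact (closure Ω)) {w : H} (hw : ‖w‖ = 1) {ε : ℝ} (hε : 0 < ε) :
    ∃ L : Set Sp, IsCompact L ∧ ∀ u ∈ Ω, √(∫ s in Lᶜ, ‖⟪w, π s u⟫‖ ^ 2 ∂μ) ≤ ε := by
  have hInt : ∀ u, Integrable (fun s => ‖⟪w, π s u⟫‖ ^ 2) μ := fun u =>
    (memLp_two_inner_apply hcont hsq u w).integrable_norm_pow two_ne_zero
  obtain ⟨t, -, ht, hcov⟩ := hΩ.finite_cover_balls (half_pos hε)
  choose L hL hLt using fun y : H =>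
    exists_isCompact_setIntegral_compl_le (hInt y) (by positivity : 0 < (ε / 2) ^ 2)
  refine ⟨⋃ y ∈ t, L y, ht.isCompact_biUnion fun y _ => hL y, fun u hu => ?_⟩
  obtain ⟨y, hy, hyu⟩ := Set.mem_iUnion₂.1 (hcov (subset_closure hu))
  rw [mem_ball_iff_norm] at hyu
  refine Real.sqrt_le_iff.2 ⟨hε.le, ?_⟩
  calc ∫ s in (⋃ y ∈ t, L y)ᶜ, ‖⟪w, π s u⟫‖ ^ 2 ∂μ
      ≤ ∫ s in (L y)ᶜ, ‖⟪w, π s u⟫‖ ^ 2 ∂μ :=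
        setIntegral_mono_set (hInt u).integrableOn (.of_forall fun s => by positivity)
          (Set.compl_subset_compl.2 (Set.subset_biUnion_of_mem hy)).eventuallyLE
    _ ≤ ∫ s in (L y)ᶜ, (2 * ‖⟪w, π s (u - y)⟫‖ ^ 2 + 2 * ‖⟪w, π s y⟫‖ ^ 2) ∂μ := by
        refine integral_mono (hInt u).integrableOn
          (((hInt _).const_mul 2).add ((hInt _).const_mul 2)).integrableOn fun s => ?_
        have htri : ‖⟪w, π s u⟫‖ ≤ ‖⟪w, π s (u - y)⟫‖ + ‖⟪w, π s y⟫‖ := by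
          refine le_trans (le_of_eq ?_) (norm_add_le _ _)
          rw [← inner_add_right, ← map_add, sub_add_cancel]
        dsimp only
        nlinarith [norm_nonneg ⟪w, π s u⟫, sq_nonneg (‖⟪w, π s (u - y)⟫‖ - ‖⟪w, π s y⟫‖)]
    _ = 2 * ∫ s in (L y)ᶜ, ‖⟪w, π s (u - y)⟫‖ ^ 2 ∂μ +
        2 * ∫ s in (L y)ᶜ, ‖⟪w, π s y⟫‖ ^ 2 ∂μ := by
        rw [integral_add ((hInt _).const_mul 2).integrableOn
          ((hInt _).const_mul 2).integrableOn, integral_const_mul, integral_const_mul]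
    _ ≤ 2 * (ε / 2) ^ 2 + 2 * (ε / 2) ^ 2 := by
        gcongr
        · refine (setIntegral_le_integral (hInt _) (.of_forall fun s => by positivity)).trans ?_
          rw [hsq, hw, one_pow, mul_one]
          gcongr
        · exact hLt y
    _ = ε ^ 2 := by ring

/-- A bounded set with tight coefficients is relatively compact. -/
theorem isCompact_closure_of_tight [IsFiniteMeasureOnCompacts μ]
    (hcont : ∀ u : H, Continuous fun s => ContinuousLinearMap.adjoint (π s) u)
    (hsq : ∀ u v : H, ∫ s, ‖⟪v, π s u⟫‖ ^ 2 ∂μ = ‖u‖ ^ 2 * ‖v‖ ^ 2)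
    {Ω : Set H} (hΩ : Bornology.IsBounded Ω) {w : H} (hw : ‖w‖ = 1)
    (htight : ∀ ε > (0 : ℝ), ∃ L : Set Sp, IsCompact L ∧
      ∀ u ∈ Ω, √(∫ s in Lᶜ, ‖⟪w, π s u⟫‖ ^ 2 ∂μ) ≤ ε) :
    IsCompact (closure Ω) := by
  have hmem := memLp_two_inner_apply hcont hsq
  have hInt : ∀ u, Integrable (fun s => ‖⟪w, π s u⟫‖ ^ 2) μ := fun u =>
    (hmem u w).integrable_norm_pow two_ne_zero
  have hsqrt : ∀ (S : Set Sp) (u : H), √(∫ s in S, ‖⟪w, π s u⟫‖ ^ 2 ∂μ) ≤ ‖u‖ := fun S u => by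
    refine Real.sqrt_le_iff.2 ⟨norm_nonneg _, ?_⟩
    refine (setIntegral_le_integral (hInt u) (.of_forall fun s => by positivity)).trans ?_
    rw [hsq, hw, one_pow, mul_one]
  refine isCompact_closure_of_inner_orthogonal_le hΩ fun ε hε => ?_
  obtain ⟨R, hR, hΩR⟩ := hΩ.exists_pos_norm_le
  obtain ⟨L, hL, hLΩ⟩ := htight (ε / 2) (half_pos hε)
  set m := √(μ.real L) with hm
  have hm₀ : 0 ≤ m := Real.sqrt_nonneg _
  set δ := ε / (2 * R * (m + 1)) with hδ
  have hδ₀ : 0 < δ := by positivity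
  obtain ⟨t, -, ht, hcov⟩ := (hL.image (hcont w)).finite_cover_balls hδ₀
  have := ht.to_subtype
  refine ⟨Submodule.span ℂ t, FiniteDimensional.span_of_finite ℂ ht, fun u hu x hx => ?_⟩
  have hsmall : ∀ s ∈ L, ‖⟪w, π s x⟫‖ ≤ δ * ‖x‖ := fun s hs => by
    obtain ⟨y, hy, hys⟩ := Set.mem_iUnion₂.1 (hcov (Set.mem_image_of_mem _ hs))
    rw [mem_ball_iff_norm] at hys
    have hyx : ⟪y, x⟫ = 0 := (Submodule.mem_orthogonal _ _).1 hx y (Submodule.subset_span hy)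
    rw [← ContinuousLinearMap.adjoint_inner_left,
      ← sub_zero ⟪ContinuousLinearMap.adjoint (π s) w, x⟫, ← hyx, ← inner_sub_left]
    exact (norm_inner_le_norm _ _).trans (by gcongr)
  have hsmallInt : √(∫ s in L, ‖⟪w, π s x⟫‖ ^ 2 ∂μ) ≤ δ * ‖x‖ * m := by
    have hle : ∫ s in L, ‖⟪w, π s x⟫‖ ^ 2 ∂μ ≤ (δ * ‖x‖) ^ 2 * μ.real L := by
      calc ∫ s in L, ‖⟪w, π s x⟫‖ ^ 2 ∂μ ≤ ∫ s in L, (δ * ‖x‖) ^ 2 ∂μ :=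
            setIntegral_mono_on (hInt x).integrableOn
              (integrableOn_const hL.measure_lt_top.ne) hL.measurableSet fun s hs => by
                gcongr; exact hsmall s hs
        _ = (δ * ‖x‖) ^ 2 * μ.real L := by rw [setIntegral_const, smul_eq_mul, mul_comm]
    refine (Real.sqrt_le_sqrt hle).trans (le_of_eq ?_)
    rw [Real.sqrt_mul (by positivity), Real.sqrt_sq (by positivity)]
  have hinner : ⟪x, u⟫ = ∫ s, ⟪⟪w, π s x⟫, ⟪w, π s u⟫⟫ ∂μ := by
    have h₁ := inner_coeffLp_same hmem hsq x u w
    rw [hw] at h₁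
    rw [← (hmem x w).inner_toLp_eq_integral (hmem u w)]
    simpa [coeffLp] using h₁.symm
  have hprod : Integrable (fun s => ⟪⟪w, π s x⟫, ⟪w, π s u⟫⟫) μ :=
    (hmem x w).integrable_inner (hmem u w)
  rw [hinner, ← integral_add_compl hL.measurableSet hprod]
  calc _ ≤ √(∫ s in L, ‖⟪w, π s x⟫‖ ^ 2 ∂μ) * √(∫ s in L, ‖⟪w, π s u⟫‖ ^ 2 ∂μ) +
        √(∫ s in Lᶜ, ‖⟪w, π s x⟫‖ ^ 2 ∂μ) * √(∫ s in Lᶜ, ‖⟪w, π s u⟫‖ ^ 2 ∂μ) :=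
        (norm_add_le _ _).trans <| add_le_add
          (((hmem x w).restrict L).norm_integral_inner_le ((hmem u w).restrict L))
          (((hmem x w).restrict Lᶜ).norm_integral_inner_le ((hmem u w).restrict Lᶜ))
    _ ≤ δ * ‖x‖ * m * R + ‖x‖ * (ε / 2) := by
        gcongr
        · exact (hsqrt L u).trans (hΩR u hu)
        · exact hsqrt _ x
        · exact hLΩ u hu
    _ ≤ δ * ‖x‖ * (m + 1) * R + ‖x‖ * (ε / 2) := by gcongr; linarith
    _ = ε * ‖x‖ := by rw [hδ]; field_simp; ring

/-- The operators `u ↦ ∫ f(s) π(s)* u dμ(s)` approximate the identity on any set on which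
`s ↦ π(s)*` is uniformly continuous at a point of the support of `μ` where it is the identity. -/
theorem exists_norm_integral_smul_sub_le [LocallyCompactSpace Sp] [IsFiniteMeasureOnCompacts μ]
    [SecondCountableTopology H] {A : Sp → H →L[ℂ] H} (hA : ∀ u, Continuous fun s => A s u)
    {s₁ : Sp} (hs₁ : ∀ U ∈ 𝓝 s₁, μ U ≠ 0) (hAs₁ : A s₁ = ContinuousLinearMap.id ℂ H)
    {Ω : Set H} {ε : ℝ} (hev : ∀ᶠ s in 𝓝 s₁, ∀ u ∈ Ω, ‖A s u - A s₁ u‖ ≤ ε) :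
    ∃ f : Sp → ℂ, Continuous f ∧ HasCompactSupport f ∧
      ∀ u ∈ Ω, ‖(∫ s, f s • A s u ∂μ) - u‖ ≤ ε := by
  obtain ⟨U, hU, hUo, hsU⟩ := eventually_nhds_iff.1 hev
  obtain ⟨f, hf₁, hf₀, hfc, hf⟩ := exists_continuous_one_zero_of_isCompact
    (isCompact_singleton (x := s₁)) hUo.isClosed_compl
    (Set.disjoint_singleton_left.2 (Set.notMem_compl_iff.2 hsU))
  have hfint : Integrable f μ := f.continuous.integrable_of_hasCompactSupport hfc
  have hf₁' : f s₁ = 1 := hf₁ rfl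
  set c := ∫ s, f s ∂μ with hc
  have hcpos : 0 < c := by
    rw [hc, integral_pos_iff_support_of_nonneg (fun s => (hf s).1) hfint]
    refine pos_iff_ne_zero.2 (hs₁ _ (f.continuous.isOpen_support.mem_nhds ?_))
    simp [hf₁']
  have hgcont : Continuous fun s => ((c⁻¹ * f s : ℝ) : ℂ) := by fun_prop
  have hgsupp : HasCompactSupport fun s => ((c⁻¹ * f s : ℝ) : ℂ) :=
    hfc.comp_left (g := fun r : ℝ => ((c⁻¹ * r : ℝ) : ℂ)) (by simp)
  refine ⟨_, hgcont, hgsupp, fun u hu => ?_⟩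
  have hone : ∫ s, ((c⁻¹ * f s : ℝ) : ℂ) ∂μ = 1 := by
    rw [integral_complex_ofReal, integral_const_mul, ← hc, inv_mul_cancel₀ hcpos.ne',
      Complex.ofReal_one]
  have hInt₁ : Integrable (fun s => ((c⁻¹ * f s : ℝ) : ℂ) • A s u) μ :=
    (hgcont.smul (hA u)).integrable_of_hasCompactSupport hgsupp.smul_right
  have hInt₂ : Integrable (fun s => ((c⁻¹ * f s : ℝ) : ℂ) • u) μ :=
    (hgcont.smul continuous_const).integrable_of_hasCompactSupport hgsupp.smul_right
  have hsub : (∫ s, ((c⁻¹ * f s : ℝ) : ℂ) • A s u ∂μ) - u =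
      ∫ s, ((c⁻¹ * f s : ℝ) : ℂ) • (A s u - u) ∂μ := by
    simp only [smul_sub]
    rw [integral_sub hInt₁ hInt₂, integral_smul_const, hone, one_smul]
  rw [hsub]
  calc _ ≤ ∫ s, c⁻¹ * f s * ε ∂μ := by
        refine norm_integral_le_of_norm_le ((hfint.const_mul _).mul_const _)
          (.of_forall fun s => ?_)
        have hnonneg : 0 ≤ c⁻¹ * f s := mul_nonneg (inv_nonneg.2 hcpos.le) (hf s).1
        rw [norm_smul, Complex.norm_real, Real.norm_of_nonneg hnonneg]
        by_cases hs : s ∈ U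
        · have := hU s hs u hu
          rw [hAs₁] at this
          exact mul_le_mul_of_nonneg_left this hnonneg
        · have : f s = 0 := hf₀ hs
          simp [this]
    _ = ε := by
        rw [integral_mul_const, integral_const_mul, ← hc, inv_mul_cancel₀ hcpos.ne', one_mul]

end Topological

/-- Assume the square-integrability condition, the surjectivity
assumption, and that `π(s₁)* = Id_H` for some `s₁` in the support of `μ`; let `Ω ⊆ H` be
bounded.  Then the following are equivalent: (1) `Ω` is relatively compact; (2) for some
(equivalently, every) unit vector `w`, the family `φ^π_w(Ω)` is `K(Sp)`-tight in `L²`;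
(3) for every `ε > 0` there is `f ∈ C_c(Sp)` with `sup_{u ∈ Ω} ‖Π(f)u − u‖ ≤ ε`;
(4) `lim_{s → s₀} sup_{u ∈ Ω} ‖π(s)*u − π(s₀)*u‖ = 0` for every `s₀ ∈ Sp`.
(Here `(φ^π_w u) s = ⟨π(s)u, w⟩` is `⟪w, π s u⟫` in Mathlib conventions, and
`Π(f)u = ∫ f(s) π(s)* u dμ(s)`.) -/
theorem statement8
    {Sp : Type*} [TopologicalSpace Sp] [T2Space Sp] [LocallyCompactSpace Sp]
    [SigmaCompactSpace Sp] [MeasurableSpace Sp] [BorelSpace Sp]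
    (μ : Measure Sp) [μ.Regular]
    {H : Type*} [NormedAddCommGroup H] [InnerProductSpace ℂ H] [CompleteSpace H]
    [TopologicalSpace.SeparableSpace H] [Nontrivial H]
    (π : Sp → H →L[ℂ] H)
    (hcont : ∀ u : H, Continuous fun s => ContinuousLinearMap.adjoint (π s) u)
    (hsq : ∀ u v : H, ∫ s, ‖⟪v, π s u⟫‖ ^ 2 ∂μ = ‖u‖ ^ 2 * ‖v‖ ^ 2)
    (hsurj : (Submodule.span ℂ {f : Lp ℂ 2 μ | ∃ u v : H,
        (f : Sp → ℂ) =ᵐ[μ] fun s => ⟪v, π s u⟫}).topologicalClosure = ⊤)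
    (hs₁ : ∃ s₁ : Sp, (∀ U ∈ 𝓝 s₁, μ U ≠ 0) ∧
      ContinuousLinearMap.adjoint (π s₁) = ContinuousLinearMap.id ℂ H)
    (Ω : Set H) (hΩ : Bornology.IsBounded Ω) :
    -- (1) ↔ (2) for some unit vector
    (IsCompact (closure Ω) ↔
      ∃ w : H, ‖w‖ = 1 ∧ ∀ ε > (0:ℝ), ∃ L : Set Sp, IsCompact L ∧
        ∀ u ∈ Ω, Real.sqrt (∫ s in Lᶜ, ‖⟪w, π s u⟫‖ ^ 2 ∂μ) ≤ ε) ∧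
    -- (1) ↔ (2) for every unit vector
    (IsCompact (closure Ω) ↔
      ∀ w : H, ‖w‖ = 1 → ∀ ε > (0:ℝ), ∃ L : Set Sp, IsCompact L ∧
        ∀ u ∈ Ω, Real.sqrt (∫ s in Lᶜ, ‖⟪w, π s u⟫‖ ^ 2 ∂μ) ≤ ε) ∧
    -- (1) ↔ (3)
    (IsCompact (closure Ω) ↔
      ∀ ε > (0:ℝ), ∃ f : Sp → ℂ, Continuous f ∧ HasCompactSupport f ∧
        ∀ u ∈ Ω, ‖(∫ s, f s • ContinuousLinearMap.adjoint (π s) u ∂μ) - u‖ ≤ ε) ∧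
    -- (1) ↔ (4)
    (IsCompact (closure Ω) ↔
      ∀ s₀ : Sp, ∀ ε > (0:ℝ), ∀ᶠ s in 𝓝 s₀, ∀ u ∈ Ω,
        ‖ContinuousLinearMap.adjoint (π s) u - ContinuousLinearMap.adjoint (π s₀) u‖ ≤ ε) := by
  have : SecondCountableTopology H := UniformSpace.secondCountable_of_separable H
  have h_tight : IsCompact (closure Ω) → ∀ w : H, ‖w‖ = 1 → ∀ ε > (0 : ℝ), ∃ L : Set Sp,
      IsCompact L ∧ ∀ u ∈ Ω, √(∫ s in Lᶜ, ‖⟪w, π s u⟫‖ ^ 2 ∂μ) ≤ ε :=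
    fun hc w hw ε hε => tight_of_isCompact_closure hcont hsq hc hw hε
  have h_equi : IsCompact (closure Ω) → ∀ s₀ : Sp, ∀ ε > (0 : ℝ), ∀ᶠ s in 𝓝 s₀, ∀ u ∈ Ω,
      ‖ContinuousLinearMap.adjoint (π s) u - ContinuousLinearMap.adjoint (π s₀) u‖ ≤ ε :=
    fun hc s₀ ε hε => eventually_norm_sub_le_of_isCompact_closure hcont hc s₀ hε
  obtain ⟨w₀, hw₀⟩ := exists_norm_eq H zero_le_one
  obtain ⟨s₁, hsupp, hid⟩ := hs₁
  refine ⟨⟨fun hc => ⟨w₀, hw₀, h_tight hc w₀ hw₀⟩, fun ⟨w, hw, ht⟩ =>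
      isCompact_closure_of_tight hcont hsq hΩ hw ht⟩,
    ⟨h_tight, fun ht => isCompact_closure_of_tight hcont hsq hΩ hw₀ (ht w₀ hw₀)⟩,
    ⟨fun hc ε hε => exists_norm_integral_smul_sub_le hcont hsupp hid (h_equi hc s₁ ε hε),
      isCompact_closure_of_norm_integral_smul_sub_le hcont hsq hsurj hΩ⟩,
    ⟨h_equi, fun he => isCompact_closure_of_norm_integral_smul_sub_le hcont hsq hsurj hΩ
      fun ε hε => exists_norm_integral_smul_sub_le hcont hsupp hid (he s₁ ε hε)⟩⟩
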